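/- Let (𝔸, K₁) and (𝔹, K₂) be Boolean kits. Define the kit K₁ ⊸ K₂ on the groupoid 𝔸ᵒᵖ × 𝔹 by letting (K₁ ⊸ K₂)(a, b) be the set of all subgroups H ≤ End(a) × End(b) ≅ End((a,b)) such that for all (α, β) ∈ H: α ∈ ⋃K₁(a) implies β ∈ ⋃K₂(b), and β ∈ ⋃K₂^⊥(b) implies α ∈ ⋃K₁^⊥(a). Then K₁ ⊸ K₂ is a Boolean kit, i.e., (K₁ ⊸ K₂) = (K₁ ⊸ K₂)^⊥⊥. -/

import Mathlib

open CategoryTheory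

universe v u v₁ v₂ u₁ u₂

/-- Conjugation of endomorphisms along a morphism `α : a' ⟶ a` in a groupoid,
as a group homomorphism `End a →* End a'`. -/
def conjHom {A : Type u} [Groupoid.{v} A] {a a' : A} (α : a' ⟶ a) :
    CategoryTheory.End a →* CategoryTheory.End a' where
  toFun g := α ≫ g ≫ Groupoid.inv α
  map_one' := by
    show α ≫ 𝟙 a ≫ Groupoid.inv α = 𝟙 a'
    simp
  map_mul' g h := by
    show α ≫ (h ≫ g) ≫ Groupoid.inv α =
      (α ≫ h ≫ Groupoid.inv α) ≫ (α ≫ g ≫ Groupoid.inv α)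
    simp

/-- The conjugate subgroup `α⁻¹ ∘ G ∘ α ≤ End a'` of `G ≤ End a` along `α : a' ⟶ a`. -/
def conjSub {A : Type u} [Groupoid.{v} A] {a a' : A} (α : a' ⟶ a)
    (G : Subgroup (CategoryTheory.End a)) : Subgroup (CategoryTheory.End a') :=
  G.map (conjHom α)

/-- A kit on a groupoid: a conjugation-closed family of sets of subgroups of vertex groups. -/
structure Kit (A : Type u) [Groupoid.{v} A] where
  K : ∀ a : A, Set (Subgroup (CategoryTheory.End a))
  conj_mem : ∀ {a a' : A} (α : a' ⟶ a), ∀ G ∈ K a, conjSub α G ∈ K a'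

/-- The orthogonal of a set of subgroups: subgroups meeting every member trivially. -/
def orthSet {G : Type*} [Group G] (S : Set (Subgroup G)) : Set (Subgroup G) :=
  {H | ∀ J ∈ S, H ⊓ J = ⊥}

/-- A kit is Boolean when each component is closed under double orthogonality. -/
def Kit.IsBoolean {A : Type u} [Groupoid.{v} A] (K : Kit A) : Prop :=
  ∀ a : A, K.K a = orthSet (orthSet (K.K a))

/-- The union of all the subgroups in a set of subgroups. -/
def unionOf {G : Type*} [Group G] (S : Set (Subgroup G)) : Set G :=
  ⋃ H ∈ S, (H : Set G)

section Prod

variable {A : Type u₁} {B : Type u₂} [Groupoid.{v₁} A] [Groupoid.{v₂} B]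

/-- First projection `End (a, b) →* End a` in a product groupoid. -/
def endFst (a : A) (b : B) :
    CategoryTheory.End ((a, b) : A × B) →* CategoryTheory.End a where
  toFun γ := γ.1
  map_one' := rfl
  map_mul' _ _ := rfl

/-- Second projection `End (a, b) →* End b` in a product groupoid. -/
def endSnd (a : A) (b : B) :
    CategoryTheory.End ((a, b) : A × B) →* CategoryTheory.End b where
  toFun γ := γ.2
  map_one' := rfl
  map_mul' _ _ := rfl

/-- The product subgroup `G × H ≤ End (a, b) ≅ End a × End b`. -/
def prodSubgroup {a : A} {b : B} (G : Subgroup (CategoryTheory.End a))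
    (H : Subgroup (CategoryTheory.End b)) :
    Subgroup (CategoryTheory.End ((a, b) : A × B)) :=
  (G.comap (endFst a b)) ⊓ (H.comap (endSnd a b))

/-- The set of product subgroups `G × H` with `G ∈ S` and `H ∈ T`. -/
def prodSet {a : A} {b : B} (S : Set (Subgroup (CategoryTheory.End a)))
    (T : Set (Subgroup (CategoryTheory.End b))) :
    Set (Subgroup (CategoryTheory.End ((a, b) : A × B))) :=
  {P | ∃ G ∈ S, ∃ H ∈ T, P = prodSubgroup G H}

end Prod

/-- The linear-arrow set of subgroups `(S ⊸ T)(a,b)`: subgroups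
`H ≤ End a × End b` such that for all `(α, β) ∈ H`, `α ∈ ⋃S → β ∈ ⋃T` and
`β ∈ ⋃T^⊥ → α ∈ ⋃S^⊥`. -/
def linArrowSet {A : Type u₁} {B : Type u₂} [Groupoid.{v₁} A] [Groupoid.{v₂} B]
    {a : A} {b : B} (S : Set (Subgroup (CategoryTheory.End a)))
    (T : Set (Subgroup (CategoryTheory.End b))) :
    Set (Subgroup (CategoryTheory.End ((a, b) : A × B))) :=
  {H | ∀ γ ∈ H,
    (endFst a b γ ∈ unionOf S → endSnd a b γ ∈ unionOf T) ∧
    (endSnd a b γ ∈ unionOf (orthSet T) → endFst a b γ ∈ unionOf (orthSet S))}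

theorem orthSet_triple {G : Type*} [Group G] (S : Set (Subgroup G)) :
    orthSet (orthSet (orthSet S)) = orthSet S := by
  ext H
  constructor
  · intro h J hJ
    refine h J ?_
    intro L hL
    rw [inf_comm]
    exact hL J hJ
  · intro h J hJ
    rw [inf_comm]
    exact hJ H h

theorem mem_unionOf {G : Type*} [Group G] {S : Set (Subgroup G)} {x : G} :
    x ∈ unionOf S ↔ ∃ H ∈ S, x ∈ H := by
  simp [unionOf]

theorem mem_unionOf_orth {G : Type*} [Group G] {S : Set (Subgroup G)} {x : G}
    (h : ∀ n : ℤ, ∀ J ∈ S, x ^ n ∈ J → x ^ n = 1) : x ∈ unionOf (orthSet S) := by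
  rw [mem_unionOf]
  refine ⟨Subgroup.zpowers x, ?_, Subgroup.mem_zpowers x⟩
  intro J hJ
  rw [eq_bot_iff]
  rintro y ⟨hy, hyJ⟩
  obtain ⟨n, rfl⟩ := Subgroup.mem_zpowers_iff.1 hy
  exact Subgroup.mem_bot.2 (h n J hJ hyJ)

theorem eq_one_of_mem_orth {G : Type*} [Group G] {S : Set (Subgroup G)} {x : G}
    (h : x ∈ unionOf S) (h' : x ∈ unionOf (orthSet S)) : x = 1 := by
  obtain ⟨H, hH, hx⟩ := mem_unionOf.1 h
  obtain ⟨J, hJ, hx'⟩ := mem_unionOf.1 h'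
  have : x ∈ J ⊓ H := ⟨hx', hx⟩
  rw [hJ H hH] at this
  exact Subgroup.mem_bot.1 this

theorem linArrowSet_eq {A : Type u₁} {B : Type u₂} [Groupoid.{v₁} A] [Groupoid.{v₂} B]
    {a : A} {b : B} (S : Set (Subgroup (CategoryTheory.End a)))
    (T : Set (Subgroup (CategoryTheory.End b))) (hT : T = orthSet (orthSet T)) :
    linArrowSet S T = orthSet (prodSet S (orthSet T)) := by
  ext H
  constructor
  · rintro h P ⟨G, hG, L, hL, rfl⟩
    rw [eq_bot_iff]
    rintro γ ⟨hγ, hγG, hγL⟩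
    have hS : endFst a b γ ∈ unionOf S := mem_unionOf.2 ⟨G, hG, hγG⟩
    have hT' : endSnd a b γ ∈ unionOf (orthSet T) := mem_unionOf.2 ⟨L, hL, hγL⟩
    have e1 := eq_one_of_mem_orth hS ((h γ hγ).2 hT')
    have e2 := eq_one_of_mem_orth ((h γ hγ).1 hS) hT'
    exact Subgroup.mem_bot.2 (Prod.ext e1 e2)
  · intro h γ hγ
    have key : ∀ n : ℤ, ∀ G ∈ S, ∀ L ∈ orthSet T, endFst a b γ ^ n ∈ G →
        endSnd a b γ ^ n ∈ L → γ ^ n = 1 := by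
      intro n G hG L hL h1 h2
      have hm : γ ^ n ∈ H ⊓ prodSubgroup G L := by
        refine ⟨H.zpow_mem hγ n, ?_, ?_⟩
        · show endFst a b (γ ^ n) ∈ G
          rwa [map_zpow]
        · show endSnd a b (γ ^ n) ∈ L
          rwa [map_zpow]
      rw [h _ ⟨G, hG, L, hL, rfl⟩] at hm
      exact Subgroup.mem_bot.1 hm
    constructor
    · intro h1
      obtain ⟨G, hG, hx⟩ := mem_unionOf.1 h1
      rw [hT]
      refine mem_unionOf_orth fun n L hL hn => ?_
      rw [← map_zpow, key n G hG L hL (G.zpow_mem hx n) hn, map_one]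
    · intro h1
      obtain ⟨L, hL, hx⟩ := mem_unionOf.1 h1
      refine mem_unionOf_orth fun n G hG hn => ?_
      rw [← map_zpow, key n G hG L hL hn (L.zpow_mem hx n), map_one]

/-- For Boolean kits `(A, K₁)` and `(B, K₂)`, the linear-arrow kit
`K₁ ⊸ K₂` is Boolean: at each pair of objects it equals its double orthogonal. -/
theorem linArrow_isBoolean {A : Type u₁} {B : Type u₂} [Groupoid.{v₁} A] [Groupoid.{v₂} B]
    (K₁ : Kit A) (K₂ : Kit B) (h₁ : K₁.IsBoolean) (h₂ : K₂.IsBoolean) (a : A) (b : B) :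
    linArrowSet (K₁.K a) (K₂.K b) = orthSet (orthSet (linArrowSet (K₁.K a) (K₂.K b))) := by
  rw [linArrowSet_eq _ _ (h₂ b), orthSet_triple]
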